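/- arXiv:2508.19453 — 10 statements merged into one kernel-verified Lean document; each statement's English description precedes it below -/
import Mathlib

section
/- There exists α_s ∈ (0,1) with ζ(α_s) = 0, i.e. α_s + φ̂(1 − φ̂(α_s)) = 1; equivalently, the map ξ has at least one fixed point α_s ∈ (0,1). -/
/-- There exists α_s ∈ (0,1) with ζ(α_s) = 0, i.e.
α_s + φ̂(1 − φ̂(α_s)) = 1; equivalently ξ has a fixed point α_s ∈ (0,1). -/
theorem stmt_1 (K : ℕ) (hK : 3 ≤ K) (p : ℕ → ℝ)
    (hp_nonneg : ∀ k, 0 ≤ p k)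
    (hp_sum : ∑ k ∈ Finset.Icc 1 K, p k = 1)
    (hp1 : 0 < p 1)
    (hcond : 0 < ∑ k ∈ Finset.Icc 1 K, (k : ℝ) * ((k : ℝ) - 2) * p k)
    (lam : ℝ) (hlam : lam = ∑ k ∈ Finset.Icc 1 K, (k : ℝ) * p k)
    (phiHat : ℝ → ℝ)
    (hphiHat : ∀ x, phiHat x = (∑ k ∈ Finset.Icc 1 K, (k : ℝ) * p k * x ^ (k - 1)) / lam)
    (zeta : ℝ → ℝ)
    (hzeta : ∀ α, zeta α = α + phiHat (1 - phiHat α) - 1)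
    (xi : ℝ → ℝ)
    (hxi : ∀ α, xi α = 1 - phiHat (1 - phiHat α)) :
    ∃ αs ∈ Set.Ioo (0:ℝ) 1, zeta αs = 0 ∧
      αs + phiHat (1 - phiHat αs) = 1 ∧ xi αs = αs := by
  have h1 : 1 ∈ Finset.Icc 1 K := Finset.mem_Icc.2 ⟨le_refl 1, by omega⟩
  rw [← Finset.add_sum_erase _ _ h1] at hcond
  have hlam2 := hlam
  rw [← Finset.add_sum_erase _ _ h1] at hlam2
  have hle : ∑ k ∈ (Finset.Icc 1 K).erase 1, (k : ℝ) * ((k : ℝ) - 2) * p k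
      ≤ (K : ℝ) * ∑ k ∈ (Finset.Icc 1 K).erase 1, (k : ℝ) * p k := by
    rw [Finset.mul_sum]
    apply Finset.sum_le_sum
    intro k hk
    have hkK : (k : ℝ) ≤ K := by
      exact_mod_cast (Finset.mem_Icc.1 (Finset.mem_of_mem_erase hk)).2
    have hkp : 0 ≤ (k : ℝ) * p k := mul_nonneg (Nat.cast_nonneg k) (hp_nonneg k)
    nlinarith
  have hK0 : (0 : ℝ) < K := by
    have : 0 < K := by omega
    exact_mod_cast this
  have hpos : 0 < ∑ k ∈ (Finset.Icc 1 K).erase 1, (k : ℝ) * p k := by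
    push_cast at hcond
    have : 0 < (K : ℝ) * ∑ k ∈ (Finset.Icc 1 K).erase 1, (k : ℝ) * p k := by linarith
    exact pos_of_mul_pos_right this hK0.le
  have hlt : p 1 < lam := by
    push_cast at hlam2
    linarith
  have hl0 : 0 < lam := hp1.trans hlt
  have hphi0 : phiHat 0 < 1 := by
    rw [hphiHat, div_lt_one hl0, ← Finset.add_sum_erase _ _ h1, Finset.sum_eq_zero]
    · simpa using hlt
    · intro k hk
      have hk1 := Finset.ne_of_mem_erase hk
      have hk2 := (Finset.mem_Icc.1 (Finset.mem_of_mem_erase hk)).1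
      rw [zero_pow (by omega), mul_zero]
  have hphi1 : phiHat 1 = 1 := by
    rw [hphiHat]
    simp only [one_pow, mul_one]
    rw [← hlam, div_self hl0.ne']
  have hcont : Continuous phiHat := by
    rw [show phiHat = fun x => _ from funext hphiHat]
    fun_prop
  have hc : ContinuousOn (fun x => x + phiHat x) (Set.Icc 0 1) :=
    (continuous_id.add hcont).continuousOn
  obtain ⟨a, ha, hfa⟩ := intermediate_value_Ioo (zero_le_one' ℝ) hc
    (show (1 : ℝ) ∈ Set.Ioo (0 + phiHat 0) (1 + phiHat 1) from
      ⟨by linarith, by rw [hphi1]; norm_num⟩)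
  have hfa' : a + phiHat a = 1 := hfa
  have e : 1 - phiHat a = a := by linarith
  refine ⟨a, ha, ?_, ?_, ?_⟩
  · rw [hzeta, e]; linarith
  · rw [e]; exact hfa'
  · rw [hxi, e]; exact e
end

section
/- The zero set Z = {α ∈ [0,1] : ζ(α) = 0} is a nonempty compact subset of the open interval (0,1); in particular Z has a least element α_* and a greatest element α^*, and 0 < α_* ≤ α^* < 1. -/
/-- The zero set Z = {α ∈ [0,1] : ζ(α) = 0} is a nonempty compact
subset of (0,1); in particular it has a least element α_* and a greatest element
α^*, and 0 < α_* ≤ α^* < 1. -/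
theorem stmt_2 (K : ℕ) (hK : 3 ≤ K) (p : ℕ → ℝ)
    (hp_nonneg : ∀ k, 0 ≤ p k)
    (hp_sum : ∑ k ∈ Finset.Icc 1 K, p k = 1)
    (hp1 : 0 < p 1)
    (hcond : 0 < ∑ k ∈ Finset.Icc 1 K, (k : ℝ) * ((k : ℝ) - 2) * p k)
    (lam : ℝ) (hlam : lam = ∑ k ∈ Finset.Icc 1 K, (k : ℝ) * p k)
    (phiHat : ℝ → ℝ)
    (hphiHat : ∀ x, phiHat x = (∑ k ∈ Finset.Icc 1 K, (k : ℝ) * p k * x ^ (k - 1)) / lam)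
    (zeta : ℝ → ℝ)
    (hzeta : ∀ α, zeta α = α + phiHat (1 - phiHat α) - 1) :
    ({α : ℝ | α ∈ Set.Icc (0:ℝ) 1 ∧ zeta α = 0}).Nonempty ∧
    IsCompact {α : ℝ | α ∈ Set.Icc (0:ℝ) 1 ∧ zeta α = 0} ∧
    {α : ℝ | α ∈ Set.Icc (0:ℝ) 1 ∧ zeta α = 0} ⊆ Set.Ioo 0 1 ∧
    ∃ a b : ℝ, IsLeast {α : ℝ | α ∈ Set.Icc (0:ℝ) 1 ∧ zeta α = 0} a ∧
      IsGreatest {α : ℝ | α ∈ Set.Icc (0:ℝ) 1 ∧ zeta α = 0} b ∧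
      0 < a ∧ a ≤ b ∧ b < 1 := by
  have h1mem : (1:ℕ) ∈ Finset.Icc 1 K := Finset.mem_Icc.mpr ⟨le_refl _, by omega⟩
  have hnn : ∀ k ∈ Finset.Icc 1 K, 0 ≤ (k : ℝ) * p k := fun k _ =>
    mul_nonneg (Nat.cast_nonneg k) (hp_nonneg k)
  have hp1lam : p 1 ≤ lam := by
    have h := Finset.single_le_sum hnn h1mem
    rw [hlam]
    simpa using h
  have hlampos : 0 < lam := lt_of_lt_of_le hp1 hp1lam
  obtain ⟨j, hj, hjpos⟩ := Finset.exists_lt_of_sum_lt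
    (s := Finset.Icc 1 K) (f := fun _ => (0:ℝ))
    (g := fun k : ℕ => (k : ℝ) * ((k : ℝ) - 2) * p k) (by simpa using hcond)
  have hj1 : 1 ≤ j := (Finset.mem_Icc.mp hj).1
  have hpj : 0 < p j := by
    rcases (hp_nonneg j).lt_or_eq with h | h
    · exact h
    · simp [← h] at hjpos
  have hj2 : j ≠ 1 := by
    rintro rfl
    norm_num at hjpos
    linarith
  have hlt : ∀ x : ℝ, 0 ≤ x → x < 1 → phiHat x < 1 := by
    intro x hx0 hx1
    rw [hphiHat, div_lt_one hlampos, hlam]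
    apply Finset.sum_lt_sum
    · intro k hk
      exact mul_le_of_le_one_right (hnn k hk) (pow_le_one₀ hx0 hx1.le)
    · refine ⟨j, hj, ?_⟩
      have hjj : (0:ℝ) < j * p j := mul_pos (by exact_mod_cast hj1) hpj
      exact mul_lt_of_lt_one_right hjj (pow_lt_one₀ hx0 hx1 (by omega))
  have h0 : phiHat 0 = p 1 / lam := by
    rw [hphiHat, Finset.sum_eq_single_of_mem 1 h1mem]
    · simp
    · intro k hk hk1
      have : 1 ≤ k := (Finset.mem_Icc.mp hk).1
      rw [zero_pow (by omega), mul_zero]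
  have h1 : phiHat 1 = 1 := by
    rw [hphiHat]
    simp only [one_pow, mul_one]
    rw [← hlam, div_self hlampos.ne']
  have h0pos : 0 < phiHat 0 := by rw [h0]; positivity
  have h0le : phiHat 0 < 1 := hlt 0 le_rfl one_pos
  have hz0 : zeta 0 < 0 := by
    have := hlt (1 - phiHat 0) (by linarith) (by linarith)
    rw [hzeta]; linarith
  have hz1 : 0 < zeta 1 := by
    rw [hzeta, h1, sub_self]; linarith
  have hcphi : Continuous phiHat := by
    rw [funext hphiHat]; fun_prop
  have hcz : Continuous zeta := by
    rw [funext hzeta]; fun_prop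
  have hne : ({α : ℝ | α ∈ Set.Icc (0:ℝ) 1 ∧ zeta α = 0}).Nonempty := by
    obtain ⟨c, hc, hc0⟩ := intermediate_value_Icc (zero_le_one' ℝ) hcz.continuousOn
      (show (0:ℝ) ∈ Set.Icc (zeta 0) (zeta 1) from ⟨hz0.le, hz1.le⟩)
    exact ⟨c, hc, hc0⟩
  have hcomp : IsCompact {α : ℝ | α ∈ Set.Icc (0:ℝ) 1 ∧ zeta α = 0} :=
    isCompact_Icc.inter_right (isClosed_eq hcz continuous_const)
  have hsub : {α : ℝ | α ∈ Set.Icc (0:ℝ) 1 ∧ zeta α = 0} ⊆ Set.Ioo 0 1 := by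
    rintro x ⟨⟨hx0, hx1⟩, hx⟩
    refine ⟨lt_of_le_of_ne hx0 ?_, lt_of_le_of_ne hx1 ?_⟩
    · rintro rfl; exact hz0.ne hx
    · rintro rfl; exact hz1.ne' hx
  obtain ⟨a, ha⟩ := hcomp.exists_isLeast hne
  obtain ⟨b, hb⟩ := hcomp.exists_isGreatest hne
  exact ⟨hne, hcomp, hsub, a, b, ha, hb, (hsub ha.1).1, ha.2 hb.1, (hsub hb.1).2⟩
end

section
/- The smallest and largest zeros of ζ in [0,1] are exchanged by the duality map α ↦ 1 − φ̂(α): one has α_* = 1 − φ̂(α^*) and α^* = 1 − φ̂(α_*). -/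
/-- The smallest and largest zeros of ζ in [0,1] are exchanged by
the duality map α ↦ 1 − φ̂(α): α_* = 1 − φ̂(α^*) and α^* = 1 − φ̂(α_*). -/
theorem stmt_4 (K : ℕ) (hK : 3 ≤ K) (p : ℕ → ℝ)
    (hp_nonneg : ∀ k, 0 ≤ p k)
    (hp_sum : ∑ k ∈ Finset.Icc 1 K, p k = 1)
    (hp1 : 0 < p 1)
    (hcond : 0 < ∑ k ∈ Finset.Icc 1 K, (k : ℝ) * ((k : ℝ) - 2) * p k)
    (lam : ℝ) (hlam : lam = ∑ k ∈ Finset.Icc 1 K, (k : ℝ) * p k)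
    (phiHat : ℝ → ℝ)
    (hphiHat : ∀ x, phiHat x = (∑ k ∈ Finset.Icc 1 K, (k : ℝ) * p k * x ^ (k - 1)) / lam)
    (zeta : ℝ → ℝ)
    (hzeta : ∀ α, zeta α = α + phiHat (1 - phiHat α) - 1)
    (αs αl : ℝ)
    (hαs : IsLeast {α : ℝ | α ∈ Set.Icc (0:ℝ) 1 ∧ zeta α = 0} αs)
    (hαl : IsGreatest {α : ℝ | α ∈ Set.Icc (0:ℝ) 1 ∧ zeta α = 0} αl) :
    αs = 1 - phiHat αl ∧ αl = 1 - phiHat αs := by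
  have hl0 : 0 ≤ lam := by
    rw [hlam]
    exact Finset.sum_nonneg fun k _ => mul_nonneg (Nat.cast_nonneg k) (hp_nonneg k)
  have hmono : ∀ x y : ℝ, 0 ≤ x → x ≤ y → phiHat x ≤ phiHat y := by
    intro x y hx hxy
    rw [hphiHat, hphiHat]
    refine div_le_div_of_nonneg_right (Finset.sum_le_sum fun k _ => ?_) hl0
    exact mul_le_mul_of_nonneg_left (pow_le_pow_left₀ hx hxy _)
      (mul_nonneg (Nat.cast_nonneg k) (hp_nonneg k))
  have h0 : ∀ x : ℝ, 0 ≤ x → 0 ≤ phiHat x := by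
    intro x hx
    rw [hphiHat]
    exact div_nonneg (Finset.sum_nonneg fun k _ => mul_nonneg
      (mul_nonneg (Nat.cast_nonneg k) (hp_nonneg k)) (pow_nonneg hx _)) hl0
  have h1 : phiHat 1 ≤ 1 := by
    rw [hphiHat]
    simp only [one_pow, mul_one]
    rw [← hlam]
    exact div_self_le_one lam
  have hT : ∀ a : ℝ, a ∈ Set.Icc (0:ℝ) 1 → zeta a = 0 →
      (1 - phiHat a ∈ Set.Icc (0:ℝ) 1 ∧ zeta (1 - phiHat a) = 0) := by
    intro a ha hz
    rw [hzeta] at hz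
    have e : 1 - phiHat (1 - phiHat a) = a := by linarith
    refine ⟨⟨?_, ?_⟩, ?_⟩
    · linarith [hmono a 1 ha.1 ha.2]
    · linarith [h0 a ha.1]
    · rw [hzeta, e]; ring
  obtain ⟨⟨hs, hsz⟩, hsl⟩ := hαs
  obtain ⟨⟨hl, hlz⟩, hlu⟩ := hαl
  have a1 : αs ≤ 1 - phiHat αl := hsl (hT αl hl hlz)
  have a2 : 1 - phiHat αs ≤ αl := hlu (hT αs hs hsz)
  have a3 := hmono _ _ hs.1 a1
  rw [hzeta] at hsz hlz
  have a4 : αl = 1 - phiHat αs := by linarith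
  refine ⟨?_, a4⟩
  rw [← a4] at hsz
  linarith
end

section
/- If φ̂'(α_*)·φ̂'(α^*) ≠ 1, then 0 < φ̂'(α_*)·φ̂'(α^*) < 1; in particular both α_* and α^* are stable fixed points of ξ. -/
/-- If φ̂'(α_*)·φ̂'(α^*) ≠ 1, then 0 < φ̂'(α_*)·φ̂'(α^*) < 1;
in particular both α_* and α^* are stable fixed points of ξ. -/
theorem stmt_6 (K : ℕ) (hK : 3 ≤ K) (p : ℕ → ℝ)
    (hp_nonneg : ∀ k, 0 ≤ p k)
    (hp_sum : ∑ k ∈ Finset.Icc 1 K, p k = 1)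
    (hp1 : 0 < p 1)
    (hcond : 0 < ∑ k ∈ Finset.Icc 1 K, (k : ℝ) * ((k : ℝ) - 2) * p k)
    (lam : ℝ) (hlam : lam = ∑ k ∈ Finset.Icc 1 K, (k : ℝ) * p k)
    (phiHat : ℝ → ℝ)
    (hphiHat : ∀ x, phiHat x = (∑ k ∈ Finset.Icc 1 K, (k : ℝ) * p k * x ^ (k - 1)) / lam)
    (zeta : ℝ → ℝ)
    (hzeta : ∀ α, zeta α = α + phiHat (1 - phiHat α) - 1)
    (xi : ℝ → ℝ)
    (hxi : ∀ α, xi α = 1 - phiHat (1 - phiHat α))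
    (αs αl : ℝ)
    (hαs : IsLeast {α : ℝ | α ∈ Set.Icc (0:ℝ) 1 ∧ zeta α = 0} αs)
    (hαl : IsGreatest {α : ℝ | α ∈ Set.Icc (0:ℝ) 1 ∧ zeta α = 0} αl)
    (hne : deriv phiHat αs * deriv phiHat αl ≠ 1) :
    0 < deriv phiHat αs * deriv phiHat αl ∧
    deriv phiHat αs * deriv phiHat αl < 1 ∧
    xi αs = αs ∧ xi αl = αl ∧
    |deriv xi αs| < 1 ∧ |deriv xi αl| < 1 := by
  have hk0 : ∀ k : ℕ, 0 ≤ (k : ℝ) * p k := fun k => mul_nonneg (Nat.cast_nonneg k) (hp_nonneg k)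
  have h1mem : 1 ∈ Finset.Icc 1 K := Finset.mem_Icc.2 ⟨le_refl _, by omega⟩
  have hlampos : 0 < lam := by
    rw [hlam]
    exact Finset.sum_pos' (fun k _ => hk0 k) ⟨1, h1mem, by simpa using hp1⟩
  obtain ⟨m, hm, hmpos⟩ : ∃ m ∈ Finset.Icc 1 K, 0 < (m : ℝ) * ((m : ℝ) - 2) * p m := by
    by_contra! h
    exact absurd (Finset.sum_nonpos h) (not_le.2 hcond)
  have hpm : 0 < p m := by
    rcases (hp_nonneg m).eq_or_lt with h | h
    · rw [← h] at hmpos; simp at hmpos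
    · exact h
  have hm1 : 1 < m := by
    by_contra hcon
    have : m = 1 := by have := (Finset.mem_Icc.1 hm).1; omega
    subst this
    norm_num at hmpos
    linarith
  have hfun : phiHat = fun x => (∑ k ∈ Finset.Icc 1 K, (k : ℝ) * p k * x ^ (k - 1)) / lam :=
    funext hphiHat
  have hD : ∀ x, HasDerivAt phiHat ((∑ k ∈ Finset.Icc 1 K,
      (k : ℝ) * p k * (((k - 1 : ℕ) : ℝ) * x ^ (k - 1 - 1))) / lam) x := by
    intro x
    rw [hfun]
    apply HasDerivAt.div_const
    apply HasDerivAt.fun_sum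
    intro k _
    exact (hasDerivAt_pow (k - 1) x).const_mul _
  have hDe : ∀ x, HasDerivAt phiHat (deriv phiHat x) x := fun x =>
    (hD x).differentiableAt.hasDerivAt
  have hdpos : ∀ x, 0 < x → 0 < deriv phiHat x := by
    intro x hx
    rw [(hD x).deriv]
    apply div_pos _ hlampos
    apply Finset.sum_pos'
    · intro k _
      exact mul_nonneg (hk0 k) (by positivity)
    · refine ⟨m, hm, ?_⟩
      have h1 : 0 < (m : ℝ) := by exact_mod_cast (by omega : 0 < m)
      have h2 : 0 < ((m - 1 : ℕ) : ℝ) := by exact_mod_cast (by omega : 0 < m - 1)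
      positivity
  have hcont : Continuous phiHat :=
    continuous_iff_continuousAt.2 fun x => (hD x).continuousAt
  have hmono : StrictMonoOn phiHat (Set.Ici 0) := by
    apply strictMonoOn_of_deriv_pos (convex_Ici 0) hcont.continuousOn
    intro x hx
    rw [interior_Ici] at hx
    exact hdpos x hx
  have hpos : ∀ x, 0 ≤ x → 0 < phiHat x := by
    intro x hx
    rw [hphiHat]
    apply div_pos _ hlampos
    apply Finset.sum_pos'
    · intro k _
      exact mul_nonneg (hk0 k) (by positivity)
    · exact ⟨1, h1mem, by simpa using hp1⟩
  have hone : phiHat 1 = 1 := by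
    rw [hphiHat]
    simp only [one_pow, mul_one]
    rw [← hlam, div_self hlampos.ne']
  have hle : ∀ x, 0 ≤ x → x ≤ 1 → phiHat x ≤ 1 := by
    intro x h0 h1
    rw [← hone]
    exact hmono.monotoneOn h0 (Set.mem_Ici.2 zero_le_one) h1
  obtain ⟨⟨⟨hs0, hs1⟩, hsz⟩, hsmin⟩ := hαs
  obtain ⟨⟨⟨hl0, hl1⟩, hlz⟩, hlmax⟩ := hαl
  have hz0 : zeta 0 < 0 := by
    have h0 := hpos 0 le_rfl
    have h1 := hle 0 le_rfl zero_le_one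
    have := hmono (Set.mem_Ici.2 (by linarith : 0 ≤ 1 - phiHat 0))
      (Set.mem_Ici.2 zero_le_one) (by linarith)
    rw [hzeta]
    linarith
  have hspos : 0 < αs := by
    rcases hs0.eq_or_lt with h | h
    · rw [← h] at hsz; linarith
    · exact h
  have hsl : αs ≤ αl := hsmin ⟨⟨hl0, hl1⟩, hlz⟩
  have hlpos : 0 < αl := hspos.trans_le hsl
  have key : ∀ x, 0 ≤ x → x ≤ 1 → zeta x = 0 →
      (1 - phiHat x ∈ {α : ℝ | α ∈ Set.Icc (0:ℝ) 1 ∧ zeta α = 0}) := by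
    intro x h0 h1 hx
    have a := hpos x h0
    have b := hle x h0 h1
    refine ⟨⟨by linarith, by linarith⟩, ?_⟩
    rw [hzeta] at hx
    rw [hzeta, show phiHat (1 - phiHat x) = 1 - x by linarith,
      show 1 - (1 - x) = x by ring]
    ring
  have e1 : 1 - phiHat αs ≤ αl := hlmax (key αs hs0 hs1 hsz)
  have e2 : αs ≤ 1 - phiHat αl := hsmin (key αl hl0 hl1 hlz)
  have hfs : 1 - phiHat αs = αl := by
    apply le_antisymm e1
    have := hmono.monotoneOn (Set.mem_Ici.2 hs0) (Set.mem_Ici.2 (hs0.trans e2)) e2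
    rw [hzeta] at hlz
    linarith
  have hfl : 1 - phiHat αl = αs := by
    rw [← hfs]
    rw [hzeta] at hsz
    linarith
  have hxifun : xi = fun α => 1 - phiHat (1 - phiHat α) := funext hxi
  have hxiD : ∀ x, HasDerivAt xi (deriv phiHat (1 - phiHat x) * deriv phiHat x) x := by
    intro x
    rw [hxifun]
    have h1 : HasDerivAt (fun y => 1 - phiHat y) (-deriv phiHat x) x := (hDe x).const_sub 1
    have h2 := ((hDe (1 - phiHat x)).comp x h1).const_sub 1
    have h3 : deriv phiHat (1 - phiHat x) * deriv phiHat x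
        = -(deriv phiHat (1 - phiHat x) * -deriv phiHat x) := by ring
    rw [h3]
    exact h2
  have hzc : Continuous zeta := by
    rw [funext hzeta]
    fun_prop
  have hzneg : ∀ x, 0 ≤ x → x < αs → zeta x < 0 := by
    intro x h0 hx
    by_contra! h
    obtain ⟨y, hy, hy0⟩ := intermediate_value_Icc h0 hzc.continuousOn ⟨hz0.le, h⟩
    have := hsmin ⟨⟨hy.1, by linarith [hy.2]⟩, hy0⟩
    linarith [hy.2]
  have hxs : xi αs = αs := by rw [hxi, hfs, hfl]
  have hxl : xi αl = αl := by rw [hxi, hfl, hfs]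
  have hds : deriv xi αs = deriv phiHat αs * deriv phiHat αl := by
    rw [(hxiD αs).deriv, hfs, mul_comm]
  have hdl : deriv xi αl = deriv phiHat αs * deriv phiHat αl := by
    rw [(hxiD αl).deriv, hfl]
  have hprod : 0 < deriv phiHat αs * deriv phiHat αl :=
    mul_pos (hdpos _ hspos) (hdpos _ hlpos)
  have hle1 : deriv xi αs ≤ 1 := by
    have hw : HasDerivWithinAt xi (deriv xi αs) (Set.Iio αs) αs :=
      (hxiD αs).differentiableAt.hasDerivAt.hasDerivWithinAt
    rw [hasDerivWithinAt_iff_tendsto_slope' (by simp)] at hw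
    refine le_of_tendsto hw ?_
    filter_upwards [Ioo_mem_nhdsLT hspos] with x hx
    have hz := hzneg x hx.1.le hx.2
    rw [hzeta] at hz
    rw [slope_def_field, hxs, hxi, div_le_one_of_neg (by linarith [hx.2])]
    linarith
  have hlt : deriv phiHat αs * deriv phiHat αl < 1 := by
    rw [hds] at hle1
    exact lt_of_le_of_ne hle1 hne
  refine ⟨hprod, hlt, hxs, hxl, ?_, ?_⟩
  · rw [hds, abs_of_pos hprod]; exact hlt
  · rw [hdl, abs_of_pos hprod]; exact hlt
end

section
/- The triple Δ = (1 − α^*, α_*, α^* − α_*) is a probability vector (its entries are nonnegative and sum to 1) and is a fixed point of the Warning Propagation update map: Υ(1 − α^*, α_*, α^* − α_*) = (1 − α^*, α_*, α^* − α_*), where Υ(x, y, z) = (φ̂(y), 1 − φ̂(y + z), φ̂(y + z) − φ̂(y)). -/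
/-- Δ = (1 − α^*, α_*, α^* − α_*) is a probability vector and a
fixed point of the Warning Propagation update map
Υ(x, y, z) = (φ̂(y), 1 − φ̂(y + z), φ̂(y + z) − φ̂(y)). -/
theorem stmt_9 (K : ℕ) (hK : 3 ≤ K) (p : ℕ → ℝ)
    (hp_nonneg : ∀ k, 0 ≤ p k)
    (hp_sum : ∑ k ∈ Finset.Icc 1 K, p k = 1)
    (hp1 : 0 < p 1)
    (hcond : 0 < ∑ k ∈ Finset.Icc 1 K, (k : ℝ) * ((k : ℝ) - 2) * p k)
    (lam : ℝ) (hlam : lam = ∑ k ∈ Finset.Icc 1 K, (k : ℝ) * p k)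
    (phiHat : ℝ → ℝ)
    (hphiHat : ∀ x, phiHat x = (∑ k ∈ Finset.Icc 1 K, (k : ℝ) * p k * x ^ (k - 1)) / lam)
    (zeta : ℝ → ℝ)
    (hzeta : ∀ α, zeta α = α + phiHat (1 - phiHat α) - 1)
    (αs αl : ℝ)
    (hαs : IsLeast {α : ℝ | α ∈ Set.Icc (0:ℝ) 1 ∧ zeta α = 0} αs)
    (hαl : IsGreatest {α : ℝ | α ∈ Set.Icc (0:ℝ) 1 ∧ zeta α = 0} αl)
    (Ups : ℝ × ℝ × ℝ → ℝ × ℝ × ℝ)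
    (hUps : ∀ x y z : ℝ, Ups (x, y, z) =
      (phiHat y, 1 - phiHat (y + z), phiHat (y + z) - phiHat y)) :
    0 ≤ 1 - αl ∧ 0 ≤ αs ∧ 0 ≤ αl - αs ∧
    (1 - αl) + αs + (αl - αs) = 1 ∧
    Ups (1 - αl, αs, αl - αs) = (1 - αl, αs, αl - αs) := by
  have hterm : ∀ k : ℕ, 0 ≤ (k : ℝ) * p k := fun k => mul_nonneg (Nat.cast_nonneg k) (hp_nonneg k)
  have hlampos : 0 < lam := by
    rw [hlam]
    refine Finset.sum_pos' (fun k _ => hterm k) ⟨1, ?_, ?_⟩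
    · simp; omega
    · simpa using hp1
  have hmono : ∀ x y, 0 ≤ x → x ≤ y → phiHat x ≤ phiHat y := by
    intro x y hx hxy
    rw [hphiHat, hphiHat]
    refine div_le_div_of_nonneg_right ?_ hlampos.le
    refine Finset.sum_le_sum fun k _ => ?_
    exact mul_le_mul_of_nonneg_left (pow_le_pow_left₀ hx hxy _) (hterm k)
  have h1 : phiHat 1 = 1 := by
    rw [hphiHat]
    simp only [one_pow, mul_one]
    rw [← hlam]
    exact div_self hlampos.ne'
  have h0 : ∀ x, 0 ≤ x → 0 ≤ phiHat x := by
    intro x hx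
    rw [hphiHat]
    exact div_nonneg (Finset.sum_nonneg fun k _ => mul_nonneg (hterm k) (pow_nonneg hx _)) hlampos.le
  obtain ⟨⟨⟨hs0, hs1⟩, hsz⟩, hsmin⟩ := hαs
  obtain ⟨⟨⟨hl0, hl1⟩, hlz⟩, hlmax⟩ := hαl
  have key : ∀ a, 0 ≤ a → a ≤ 1 → zeta a = 0 →
      1 - phiHat a ∈ {α : ℝ | α ∈ Set.Icc (0:ℝ) 1 ∧ zeta α = 0} := by
    intro a ha0 ha1 haz
    have e1 := h0 a ha0
    have e2 := hmono a 1 ha0 ha1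
    rw [hzeta] at haz
    refine ⟨⟨by linarith, by linarith⟩, ?_⟩
    rw [hzeta]
    have : phiHat (1 - phiHat a) = 1 - a := by linarith
    rw [this]
    have : 1 - (1 - a) = a := by ring
    rw [this]
    ring
  have ks := key αs hs0 hs1 hsz
  have kl := key αl hl0 hl1 hlz
  have a1 := hlmax ks
  have a2 := hsmin kl
  have hsl : αs ≤ αl := hlmax ⟨⟨hs0, hs1⟩, hsz⟩
  have b1 := hmono _ _ hs0 a2
  have b2 := hmono _ _ ks.1.1 a1
  rw [hzeta] at hsz hlz
  have c1 : phiHat αs = 1 - αl := by linarith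
  have c2 : phiHat αl = 1 - αs := by linarith
  refine ⟨by linarith, hs0, by linarith, by ring, ?_⟩
  rw [hUps]
  have : αs + (αl - αs) = αl := by ring
  rw [this, c1, c2]
  refine Prod.ext rfl (Prod.ext ?_ ?_)
  · show 1 - (1 - αs) = αs
    ring
  · show 1 - αs - (1 - αl) = αl - αs
    ring
end

section
/- For every α ∈ [0, α_*) one has ζ(α) < 0, equivalently α < ξ(α); moreover ξ(α) < α_*. Hence ξ maps [0, α_*) into itself and strictly increases each point of [0, α_*). -/
/-- For every α ∈ [0, α_*) one has ζ(α) < 0, equivalently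
α < ξ(α); moreover ξ(α) < α_*.  Hence ξ maps [0, α_*) into itself and strictly
increases each point of [0, α_*). -/
theorem stmt_10 (K : ℕ) (hK : 3 ≤ K) (p : ℕ → ℝ)
    (hp_nonneg : ∀ k, 0 ≤ p k)
    (hp_sum : ∑ k ∈ Finset.Icc 1 K, p k = 1)
    (hp1 : 0 < p 1)
    (hcond : 0 < ∑ k ∈ Finset.Icc 1 K, (k : ℝ) * ((k : ℝ) - 2) * p k)
    (lam : ℝ) (hlam : lam = ∑ k ∈ Finset.Icc 1 K, (k : ℝ) * p k)
    (phiHat : ℝ → ℝ)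
    (hphiHat : ∀ x, phiHat x = (∑ k ∈ Finset.Icc 1 K, (k : ℝ) * p k * x ^ (k - 1)) / lam)
    (zeta : ℝ → ℝ)
    (hzeta : ∀ α, zeta α = α + phiHat (1 - phiHat α) - 1)
    (xi : ℝ → ℝ)
    (hxi : ∀ α, xi α = 1 - phiHat (1 - phiHat α))
    (αs αl : ℝ)
    (hαs : IsLeast {α : ℝ | α ∈ Set.Icc (0:ℝ) 1 ∧ zeta α = 0} αs)
    (hαl : IsGreatest {α : ℝ | α ∈ Set.Icc (0:ℝ) 1 ∧ zeta α = 0} αl) :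
    ∀ α : ℝ, 0 ≤ α → α < αs → zeta α < 0 ∧ α < xi α ∧ xi α < αs := by
  have hlpos : 0 < lam := by
    rw [hlam]
    have h1 : (1:ℕ) ∈ Finset.Icc 1 K := by simp; omega
    refine Finset.sum_pos' (fun k _ => mul_nonneg (Nat.cast_nonneg k) (hp_nonneg k)) ⟨1, h1, ?_⟩
    simpa using hp1
  obtain ⟨m, hm, hmpos⟩ : ∃ m ∈ Finset.Icc 1 K, 0 < (m : ℝ) * ((m : ℝ) - 2) * p m := by
    by_contra! h
    exact absurd (Finset.sum_nonpos h) (not_le.mpr hcond)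
  have hm1 : 1 ≤ m := (Finset.mem_Icc.mp hm).1
  have hpm : 0 < p m := by
    rcases (hp_nonneg m).lt_or_eq with h | h
    · exact h
    · rw [← h] at hmpos; simp at hmpos
  have hm2 : m ≠ 1 := by
    rintro rfl
    norm_num at hmpos
    linarith
  have hmono : ∀ x y : ℝ, 0 ≤ x → x < y → phiHat x < phiHat y := by
    intro x y hx hxy
    rw [hphiHat, hphiHat]
    refine div_lt_div_of_pos_right ?_ hlpos
    refine Finset.sum_lt_sum (fun k _ => ?_) ⟨m, hm, ?_⟩
    · exact mul_le_mul_of_nonneg_left (pow_le_pow_left₀ hx hxy.le _)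
        (mul_nonneg (Nat.cast_nonneg k) (hp_nonneg k))
    · have hmc : (0:ℝ) < m := by exact_mod_cast hm1
      exact mul_lt_mul_of_pos_left (pow_lt_pow_left₀ hxy hx (by omega)) (mul_pos hmc hpm)
  have hone : phiHat 1 = 1 := by
    rw [hphiHat]
    simp only [one_pow, mul_one]
    rw [← hlam]
    exact div_self hlpos.ne'
  have hzero : 0 < phiHat 0 := by
    rw [hphiHat]
    refine div_pos ?_ hlpos
    have h1 : (1:ℕ) ∈ Finset.Icc 1 K := by simp; omega
    refine Finset.sum_pos' (fun k _ => mul_nonneg (mul_nonneg (Nat.cast_nonneg k) (hp_nonneg k))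
      (pow_nonneg le_rfl _)) ⟨1, h1, ?_⟩
    simpa using hp1
  have hcont : Continuous phiHat := by
    have : phiHat = fun x => (∑ k ∈ Finset.Icc 1 K, (k : ℝ) * p k * x ^ (k - 1)) / lam :=
      funext hphiHat
    rw [this]
    fun_prop
  have hzc : Continuous zeta := by
    have : zeta = fun α => α + phiHat (1 - phiHat α) - 1 := funext hzeta
    rw [this]
    fun_prop
  have hz0 : zeta 0 < 0 := by
    have h1 := hmono 0 1 le_rfl one_pos
    have h2 := hmono (1 - phiHat 0) 1 (by linarith) (by linarith)
    rw [hzeta]; linarith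
  obtain ⟨⟨⟨hs0, hs1⟩, hsz⟩, hmin⟩ := hαs
  intro α h0 hα
  have hneg : zeta α < 0 := by
    by_contra! h
    obtain ⟨c, hc, hcz⟩ := intermediate_value_Icc h0 hzc.continuousOn ⟨hz0.le, h⟩
    have := hmin ⟨⟨hc.1, by linarith [hc.2]⟩, hcz⟩
    linarith [hc.2]
  have hs : phiHat αs ≤ 1 := by
    rcases hs1.lt_or_eq with h | h
    · have := hmono αs 1 hs0 h
      linarith
    · rw [h, hone]
  have h3 := hmono α αs h0 hα
  have h4 := hmono (1 - phiHat αs) (1 - phiHat α) (by linarith) (by linarith)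
  have h5 := hzeta α
  have h6 := hzeta αs
  refine ⟨hneg, ?_, ?_⟩ <;> rw [hxi] <;> linarith
end

section
/- Define the sequence a_0 = 0 and a_{t+1} = ξ(a_t) for t ≥ 0. Then (a_t)_{t≥0} is strictly increasing, a_t < α_* for every t, and a_t → α_* as t → ∞. -/
/-- The sequence a_0 = 0, a_{t+1} = ξ(a_t) is strictly increasing,
stays below α_*, and converges to α_*. -/
theorem stmt_11 (K : ℕ) (hK : 3 ≤ K) (p : ℕ → ℝ)
    (hp_nonneg : ∀ k, 0 ≤ p k)
    (hp_sum : ∑ k ∈ Finset.Icc 1 K, p k = 1)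
    (hp1 : 0 < p 1)
    (hcond : 0 < ∑ k ∈ Finset.Icc 1 K, (k : ℝ) * ((k : ℝ) - 2) * p k)
    (lam : ℝ) (hlam : lam = ∑ k ∈ Finset.Icc 1 K, (k : ℝ) * p k)
    (phiHat : ℝ → ℝ)
    (hphiHat : ∀ x, phiHat x = (∑ k ∈ Finset.Icc 1 K, (k : ℝ) * p k * x ^ (k - 1)) / lam)
    (zeta : ℝ → ℝ)
    (hzeta : ∀ α, zeta α = α + phiHat (1 - phiHat α) - 1)
    (xi : ℝ → ℝ)
    (hxi : ∀ α, xi α = 1 - phiHat (1 - phiHat α))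
    (αs αl : ℝ)
    (hαs : IsLeast {α : ℝ | α ∈ Set.Icc (0:ℝ) 1 ∧ zeta α = 0} αs)
    (hαl : IsGreatest {α : ℝ | α ∈ Set.Icc (0:ℝ) 1 ∧ zeta α = 0} αl)
    (a : ℕ → ℝ) (ha0 : a 0 = 0) (harec : ∀ t, a (t + 1) = xi (a t)) :
    StrictMono a ∧ (∀ t, a t < αs) ∧
    Filter.Tendsto a Filter.atTop (nhds αs) := by
  have hterm : ∀ k ∈ Finset.Icc 1 K, 0 ≤ (k : ℝ) * p k := fun k _ =>
    mul_nonneg (Nat.cast_nonneg k) (hp_nonneg k)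
  have h1mem : (1 : ℕ) ∈ Finset.Icc 1 K := by simp; omega
  have hlampos : 0 < lam := by
    rw [hlam]
    exact Finset.sum_pos' hterm ⟨1, h1mem, by simpa using hp1⟩
  have hk3 : ∃ k ∈ Finset.Icc 1 K, 3 ≤ k ∧ 0 < p k := by
    by_contra hne
    push Not at hne
    refine absurd hcond (not_lt.mpr (Finset.sum_nonpos ?_))
    intro k hk
    by_cases h3 : 3 ≤ k
    · have h0 : p k = 0 := le_antisymm (hne k hk h3) (hp_nonneg k)
      simp [h0]
    · have h2 : (k : ℝ) ≤ 2 := by exact_mod_cast (by omega : k ≤ 2)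
      exact mul_nonpos_of_nonpos_of_nonneg
        (mul_nonpos_of_nonneg_of_nonpos (Nat.cast_nonneg k) (by linarith)) (hp_nonneg k)
  have hmono : ∀ x y : ℝ, 0 ≤ x → x < y → phiHat x < phiHat y := by
    intro x y hx hxy
    rw [hphiHat, hphiHat]
    refine div_lt_div_of_pos_right (Finset.sum_lt_sum ?_ ?_) hlampos
    · intro k hk
      exact mul_le_mul_of_nonneg_left (pow_le_pow_left₀ hx hxy.le _) (hterm k hk)
    · obtain ⟨k, hk, h3, hpk⟩ := hk3
      refine ⟨k, hk, mul_lt_mul_of_pos_left (pow_lt_pow_left₀ hxy hx (by omega)) ?_⟩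
      have : (0 : ℝ) < k := by exact_mod_cast (by omega : 0 < k)
      positivity
  have hone : phiHat 1 = 1 := by
    rw [hphiHat]
    simp only [one_pow, mul_one]
    rw [← hlam]
    exact div_self hlampos.ne'
  have hzero : 0 < phiHat 0 := by
    rw [hphiHat]
    refine div_pos (Finset.sum_pos' ?_ ⟨1, h1mem, by simpa using hp1⟩) hlampos
    intro k hk
    exact mul_nonneg (hterm k hk) (pow_nonneg le_rfl _)
  have hle1 : ∀ x : ℝ, 0 ≤ x → x ≤ 1 → phiHat x ≤ 1 := by
    intro x hx hx1
    rcases hx1.lt_or_eq with h | h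
    · exact hone ▸ (hmono x 1 hx h).le
    · rw [h, hone]
  have hximono : ∀ x y : ℝ, 0 ≤ x → x < y → y ≤ 1 → xi x < xi y := by
    intro x y hx hxy hy
    rw [hxi, hxi]
    have h1 := hmono x y hx hxy
    have h2 := hle1 y (by linarith) hy
    have h3 := hmono (1 - phiHat y) (1 - phiHat x) (by linarith) (by linarith)
    linarith
  have hxi0 : 0 < xi 0 := by
    rw [hxi]
    have h2 := hle1 0 le_rfl zero_le_one
    have h3 := hmono (1 - phiHat 0) 1 (by linarith) (by linarith)
    linarith
  obtain ⟨⟨⟨hs0, hs1⟩, hsz⟩, hleast⟩ := hαs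
  have hfix : xi αs = αs := by
    rw [hzeta] at hsz
    rw [hxi]
    linarith
  have hspos : 0 < αs := by
    rcases hs0.lt_or_eq with h | h
    · exact h
    · rw [← h] at hfix
      linarith
  have key : ∀ t, 0 ≤ a t ∧ a t < αs ∧ a t < a (t + 1) := by
    intro t
    induction t with
    | zero =>
      refine ⟨ha0.ge, by rw [ha0]; exact hspos, ?_⟩
      rw [harec, ha0]
      exact hxi0
    | succ t ih =>
      obtain ⟨h0, h1, h2⟩ := ih
      have h3 : a (t + 1) < αs := by
        have := hximono (a t) αs h0 h1 hs1
        rw [harec]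
        linarith
      refine ⟨by linarith, h3, ?_⟩
      have := hximono (a t) (a (t + 1)) h0 h2 (by linarith)
      rw [← harec, ← harec] at this
      exact this
  have hsm : StrictMono a := strictMono_nat_of_lt_succ fun t => (key t).2.2
  have hphicont : Continuous phiHat := by
    have : phiHat = fun x => (∑ k ∈ Finset.Icc 1 K, (k : ℝ) * p k * x ^ (k - 1)) / lam :=
      funext hphiHat
    rw [this]
    fun_prop
  have hxicont : Continuous xi := by
    have : xi = fun x => 1 - phiHat (1 - phiHat x) := funext hxi
    rw [this]
    fun_prop
  refine ⟨hsm, fun t => (key t).2.1, ?_⟩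
  have hbdd : BddAbove (Set.range a) := ⟨αs, by rintro _ ⟨t, rfl⟩; exact (key t).2.1.le⟩
  have hlim := tendsto_atTop_ciSup hsm.monotone hbdd
  generalize (⨆ i, a i) = L at hlim
  have hL0 : 0 ≤ L := ge_of_tendsto' hlim fun t => (key t).1
  have hL1 : L ≤ αs := le_of_tendsto' hlim fun t => (key t).2.1.le
  have hLfix : xi L = L := by
    have h1 := (hxicont.tendsto L).comp hlim
    have h2 := (Filter.tendsto_add_atTop_iff_nat 1).mpr hlim
    refine tendsto_nhds_unique h1 (h2.congr fun t => ?_)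
    simp [harec]
  have hge : αs ≤ L := by
    refine hleast ⟨⟨hL0, hL1.trans hs1⟩, ?_⟩
    rw [hzeta]
    rw [hxi] at hLfix
    linarith
  rw [le_antisymm hge hL1]
  exact hlim
end

section
/- Let (q_L^{(t)}, q_M^{(t)}, q_U^{(t)}) be defined by (q_L^{(0)}, q_M^{(0)}, q_U^{(0)}) = (0, 0, 1) and the recursion q_L^{(t+1)} = φ̂(q_M^{(t)}), q_M^{(t+1)} = 1 − φ̂(q_M^{(t)} + q_U^{(t)}), q_U^{(t+1)} = φ̂(q_M^{(t)} + q_U^{(t)}) − φ̂(q_M^{(t)}). Then, as t → ∞, q_M^{(t)} increases to α_*, q_L^{(t)} increases to φ̂(α_*) = 1 − α^*, and q_U^{(t)} decreases to α^* − α_*; that is, (q_L^{(t)}, q_M^{(t)}, q_U^{(t)}) → (1 − α^*, α_*, α^* − α_*). -/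
/-- For the WP recursion started at (0,0,1), as t → ∞:
q_M^{(t)} increases to α_*, q_L^{(t)} increases to φ̂(α_*) = 1 − α^*, and
q_U^{(t)} decreases to α^* − α_*. -/
theorem stmt_13 (K : ℕ) (hK : 3 ≤ K) (p : ℕ → ℝ)
    (hp_nonneg : ∀ k, 0 ≤ p k)
    (hp_sum : ∑ k ∈ Finset.Icc 1 K, p k = 1)
    (hp1 : 0 < p 1)
    (hcond : 0 < ∑ k ∈ Finset.Icc 1 K, (k : ℝ) * ((k : ℝ) - 2) * p k)
    (lam : ℝ) (hlam : lam = ∑ k ∈ Finset.Icc 1 K, (k : ℝ) * p k)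
    (phiHat : ℝ → ℝ)
    (hphiHat : ∀ x, phiHat x = (∑ k ∈ Finset.Icc 1 K, (k : ℝ) * p k * x ^ (k - 1)) / lam)
    (zeta : ℝ → ℝ)
    (hzeta : ∀ α, zeta α = α + phiHat (1 - phiHat α) - 1)
    (αs αl : ℝ)
    (hαs : IsLeast {α : ℝ | α ∈ Set.Icc (0:ℝ) 1 ∧ zeta α = 0} αs)
    (hαl : IsGreatest {α : ℝ | α ∈ Set.Icc (0:ℝ) 1 ∧ zeta α = 0} αl)
    (qL qM qU : ℕ → ℝ)
    (hL0 : qL 0 = 0) (hM0 : qM 0 = 0) (hU0 : qU 0 = 1)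
    (hLrec : ∀ t, qL (t + 1) = phiHat (qM t))
    (hMrec : ∀ t, qM (t + 1) = 1 - phiHat (qM t + qU t))
    (hUrec : ∀ t, qU (t + 1) = phiHat (qM t + qU t) - phiHat (qM t)) :
    Monotone qM ∧ Filter.Tendsto qM Filter.atTop (nhds αs) ∧
    Monotone qL ∧ Filter.Tendsto qL Filter.atTop (nhds (phiHat αs)) ∧
    phiHat αs = 1 - αl ∧
    Antitone qU ∧ Filter.Tendsto qU Filter.atTop (nhds (αl - αs)) := by
  have hlam0 : 0 < lam := by
    rw [hlam]
    refine Finset.sum_pos' (fun k _ => mul_nonneg (Nat.cast_nonneg k) (hp_nonneg k)) ⟨1, ?_, ?_⟩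
    · simp; omega
    · simpa using hp1
  have h1 : phiHat 1 = 1 := by
    rw [hphiHat]
    simp only [one_pow, mul_one]
    rw [← hlam, div_self hlam0.ne']
  have hmono : ∀ x y, 0 ≤ x → x ≤ y → phiHat x ≤ phiHat y := by
    intro x y hx hxy
    rw [hphiHat, hphiHat]
    refine div_le_div_of_nonneg_right (Finset.sum_le_sum fun k _ => ?_) hlam0.le
    exact mul_le_mul_of_nonneg_left (pow_le_pow_left₀ hx hxy _)
      (mul_nonneg (Nat.cast_nonneg k) (hp_nonneg k))
  have hnn : ∀ x, 0 ≤ x → 0 ≤ phiHat x := by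
    intro x hx
    rw [hphiHat]
    refine div_nonneg (Finset.sum_nonneg fun k _ => ?_) hlam0.le
    exact mul_nonneg (mul_nonneg (Nat.cast_nonneg k) (hp_nonneg k)) (pow_nonneg hx _)
  have hle : ∀ x, 0 ≤ x → x ≤ 1 → phiHat x ≤ 1 := fun x h0 hx => h1 ▸ hmono x 1 h0 hx
  have hcont : Continuous phiHat := by
    rw [funext hphiHat]
    fun_prop
  obtain ⟨b, hb⟩ : ∃ b : ℕ → ℝ, ∀ t, b t = qM t + qU t := ⟨_, fun _ => rfl⟩
  have hb0 : b 0 = 1 := by rw [hb, hM0, hU0]; norm_num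
  have hbs : ∀ t, b (t+1) = 1 - phiHat (qM t) := by
    intro t; rw [hb, hMrec, hUrec]; ring
  have has : ∀ t, qM (t+1) = 1 - phiHat (b t) := by
    intro t; rw [hMrec, hb]
  have hrange : ∀ t, (0 ≤ qM t ∧ qM t ≤ 1) ∧ (0 ≤ b t ∧ b t ≤ 1) := by
    intro t
    induction t with
    | zero => rw [hM0, hb0]; norm_num
    | succ t ih =>
      obtain ⟨⟨i1, i2⟩, i3, i4⟩ := ih
      rw [has, hbs]
      have := hnn _ i1; have := hnn _ i3; have := hle _ i1 i2; have := hle _ i3 i4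
      refine ⟨⟨?_, ?_⟩, ?_, ?_⟩ <;> linarith
  have hstep : ∀ t, qM t ≤ qM (t+1) ∧ b (t+1) ≤ b t := by
    intro t
    induction t with
    | zero => rw [hM0, hb0]; exact ⟨(hrange 1).1.1, (hrange 1).2.2⟩
    | succ t ih =>
      rw [has (t+1), has t, hbs (t+1), hbs t]
      rw [← has t, ← hbs t]
      have := hmono _ _ (hrange t).1.1 ih.1
      have := hmono _ _ (hrange (t+1)).2.1 ih.2
      have := has t; have := hbs t
      constructor <;> linarith
  have hz : ∀ x, 0 ≤ x → x ≤ 1 → zeta x = 0 →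
      ∀ t, (qM t ≤ x ∧ x ≤ b t) ∧ (qM t ≤ 1 - phiHat x ∧ 1 - phiHat x ≤ b t) := by
    intro x hx0 hx1 hx t
    rw [hzeta] at hx
    have e1 := hnn x hx0
    have e2 := hle x hx0 hx1
    induction t with
    | zero => rw [hM0, hb0]; refine ⟨⟨?_, ?_⟩, ?_, ?_⟩ <;> linarith
    | succ t ih =>
      obtain ⟨⟨i1, i2⟩, i3, i4⟩ := ih
      rw [has, hbs]
      have := hmono _ _ (hrange t).1.1 i1
      have := hmono _ _ (hrange t).1.1 i3
      have := hmono _ _ hx0 i2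
      have := hmono _ _ (by linarith) i4
      refine ⟨⟨?_, ?_⟩, ?_, ?_⟩ <;> linarith
  have hMm : Monotone qM := monotone_nat_of_le_succ fun t => (hstep t).1
  have hbm : Antitone b := antitone_nat_of_succ_le fun t => (hstep t).2
  obtain ⟨A, hA⟩ : ∃ A, Filter.Tendsto qM Filter.atTop (nhds A) :=
    ⟨_, tendsto_atTop_ciSup hMm ⟨1, by rintro _ ⟨t, rfl⟩; exact (hrange t).1.2⟩⟩
  obtain ⟨B, hB⟩ : ∃ B, Filter.Tendsto b Filter.atTop (nhds B) :=
    ⟨_, tendsto_atTop_ciInf hbm ⟨0, by rintro _ ⟨t, rfl⟩; exact (hrange t).2.1⟩⟩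
  have hAB : A = 1 - phiHat B := by
    refine tendsto_nhds_unique (hA.comp (Filter.tendsto_add_atTop_nat 1)) ?_
    have := ((hcont.tendsto B).comp hB).const_sub 1
    exact this.congr fun t => (has t).symm
  have hBA : B = 1 - phiHat A := by
    refine tendsto_nhds_unique (hB.comp (Filter.tendsto_add_atTop_nat 1)) ?_
    have := ((hcont.tendsto A).comp hA).const_sub 1
    exact this.congr fun t => (hbs t).symm
  obtain ⟨⟨⟨s0, s1⟩, sz⟩, smin⟩ := hαs
  obtain ⟨⟨⟨l0, l1⟩, lz⟩, lmax⟩ := hαl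
  have hAs : A = αs := by
    apply le_antisymm
    · exact le_of_tendsto' hA fun t => (hz αs s0 s1 sz t).1.1
    · refine smin ⟨⟨ge_of_tendsto' hA fun t => (hrange t).1.1,
        le_of_tendsto' hA fun t => (hrange t).1.2⟩, ?_⟩
      rw [hzeta, ← hBA]; linarith
  have hBl : B = αl := by
    apply le_antisymm
    · refine lmax ⟨⟨ge_of_tendsto' hB fun t => (hrange t).2.1,
        le_of_tendsto' hB fun t => (hrange t).2.2⟩, ?_⟩
      rw [hzeta, ← hAB]; linarith
    · exact ge_of_tendsto' hB fun t => (hz αl l0 l1 lz t).1.2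
  subst hAs hBl
  have hLb : ∀ t, qL t = 1 - b t := by
    intro t
    cases t with
    | zero => rw [hL0, hb0]; norm_num
    | succ t => rw [hLrec, hbs]; ring
  have hUb : ∀ t, qU t = b t - qM t := by
    intro t; rw [hb]; ring
  have hfin : phiHat A = 1 - B := by linarith
  refine ⟨hMm, hA, ?_, ?_, hfin, ?_, ?_⟩
  · intro s t hst
    rw [hLb, hLb]; have := hbm hst; linarith
  · rw [hfin]
    exact (hB.const_sub 1).congr fun t => (hLb t).symm
  · intro s t hst
    rw [hUb, hUb]; have := hbm hst; have := hMm hst; linarith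
  · exact (hB.sub hA).congr fun t => (hUb t).symm
end

section
/- Let G be a finite simple undirected graph, and consider the Warning Propagation messages μ^{(t)} on the darts of G (initialized at U and updated by the rule φ described in the context). Then for every dart (u, v) and every t ≥ 0, the messages are non-increasing in the order L < M < U: μ^{(t+1)}_{u→v} ≤ μ^{(t)}_{u→v}. -/
/-- For Warning Propagation on the darts of a finite simple graph,
with messages in Ω = {L, M, U} (encoded as Fin 3 with L = 0 < M = 1 < U = 2),
initialized at U and updated by the WP rule, the messages are non-increasing:
μ^{(t+1)}_{u→v} ≤ μ^{(t)}_{u→v} for every dart (u, v) and every t ≥ 0. -/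
theorem stmt_18 {V : Type*} [Fintype V] [DecidableEq V] (G : SimpleGraph V)
    [DecidableRel G.Adj]
    (μ : ℕ → V → V → Fin 3)
    (hinit : ∀ u v, G.Adj u v → μ 0 u v = 2)
    (hLrule : ∀ t u v, G.Adj u v →
      (∀ w ∈ (G.neighborFinset u).erase v, μ t w u = 1) → μ (t + 1) u v = 0)
    (hMrule : ∀ t u v, G.Adj u v →
      (∃ w ∈ (G.neighborFinset u).erase v, μ t w u = 0) → μ (t + 1) u v = 1)
    (hUrule : ∀ t u v, G.Adj u v →
      ¬ (∀ w ∈ (G.neighborFinset u).erase v, μ t w u = 1) →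
      ¬ (∃ w ∈ (G.neighborFinset u).erase v, μ t w u = 0) → μ (t + 1) u v = 2) :
    ∀ t (u v : V), G.Adj u v → μ (t + 1) u v ≤ μ t u v := by
  have key : ∀ t (u v : V), G.Adj u v → μ t u v = 2 ∨ μ (t + 1) u v = μ t u v := by
    intro t
    induction t with
    | zero => intro u v h; exact Or.inl (hinit u v h)
    | succ t ih =>
      intro u v h
      have hs : ∀ w ∈ (G.neighborFinset u).erase v, μ t w u = 2 ∨ μ (t + 1) w u = μ t w u := by
        intro w hw
        have hw' := (G.mem_neighborFinset u w).1 (Finset.mem_of_mem_erase hw)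
        exact ih w u hw'.symm
      by_cases h1 : ∀ w ∈ (G.neighborFinset u).erase v, μ t w u = 1
      · right
        rw [hLrule t u v h h1]
        apply hLrule (t + 1) u v h
        intro w hw
        rcases hs w hw with h2 | h2
        · rw [h1 w hw] at h2
          exact absurd h2 (by decide)
        · rw [h2, h1 w hw]
      · by_cases h0 : ∃ w ∈ (G.neighborFinset u).erase v, μ t w u = 0
        · right
          rw [hMrule t u v h h0]
          apply hMrule (t + 1) u v h
          obtain ⟨w, hw, hw0⟩ := h0
          refine ⟨w, hw, ?_⟩
          rcases hs w hw with h2 | h2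
          · rw [hw0] at h2
            exact absurd h2 (by decide)
          · rw [h2, hw0]
        · exact Or.inl (hUrule t u v h h1 h0)
  intro t u v h
  rcases key t u v h with h2 | h2
  · rw [h2]
    exact Fin.le_last _
  · exact h2.le
end

section
/- Let G be a finite simple undirected graph, and consider the Warning Propagation messages μ^{(t)} on the darts of G (initialized at U and updated by the rule φ described in the context). Then the messages stabilize in finitely many rounds: there exists T ≤ 2·|E(G)| such that μ^{(t)}_{u→v} = μ^{(T)}_{u→v} for every dart (u, v) and every t ≥ T; in particular μ^{(T)} is a fixed point of the update map with values in {L, M, U}. -/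
/-- Warning Propagation on the darts of a finite simple graph
(messages in Ω = {L, M, U}, encoded as Fin 3 with L = 0 < M = 1 < U = 2,
initialized at U) stabilizes in at most 2·|E(G)| rounds: there exists
T ≤ 2·|E(G)| with μ^{(t)}_{u→v} = μ^{(T)}_{u→v} for all darts (u, v) and all
t ≥ T; in particular μ^{(T)} is a fixed point of the update map. -/
theorem stmt_19 {V : Type*} [Fintype V] [DecidableEq V] (G : SimpleGraph V)
    [DecidableRel G.Adj]
    (μ : ℕ → V → V → Fin 3)
    (hinit : ∀ u v, G.Adj u v → μ 0 u v = 2)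
    (hLrule : ∀ t u v, G.Adj u v →
      (∀ w ∈ (G.neighborFinset u).erase v, μ t w u = 1) → μ (t + 1) u v = 0)
    (hMrule : ∀ t u v, G.Adj u v →
      (∃ w ∈ (G.neighborFinset u).erase v, μ t w u = 0) → μ (t + 1) u v = 1)
    (hUrule : ∀ t u v, G.Adj u v →
      ¬ (∀ w ∈ (G.neighborFinset u).erase v, μ t w u = 1) →
      ¬ (∃ w ∈ (G.neighborFinset u).erase v, μ t w u = 0) → μ (t + 1) u v = 2) :
    ∃ T ≤ 2 * G.edgeFinset.card,
      (∀ t, T ≤ t → ∀ u v : V, G.Adj u v → μ t u v = μ T u v) ∧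
      (∀ u v : V, G.Adj u v → μ (T + 1) u v = μ T u v) := by
  have hmem : ∀ u v w, w ∈ (G.neighborFinset u).erase v → G.Adj w u := by
    intro u v w hw
    rw [Finset.mem_erase, SimpleGraph.mem_neighborFinset] at hw
    exact hw.2.symm
  have hdet : ∀ s t, (∀ u v, G.Adj u v → μ s u v = μ t u v) →
      ∀ u v, G.Adj u v → μ (s + 1) u v = μ (t + 1) u v := by
    intro s t h u v huv
    by_cases h1 : ∀ w ∈ (G.neighborFinset u).erase v, μ s w u = 1
    · rw [hLrule s u v huv h1, hLrule t u v huv]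
      intro w hw
      rw [← h w u (hmem u v w hw)]; exact h1 w hw
    · by_cases h2 : ∃ w ∈ (G.neighborFinset u).erase v, μ s w u = 0
      · rw [hMrule s u v huv h2, hMrule t u v huv]
        obtain ⟨w, hw, h0⟩ := h2
        exact ⟨w, hw, by rw [← h w u (hmem u v w hw)]; exact h0⟩
      · rw [hUrule s u v huv h1 h2, hUrule t u v huv]
        · intro h3
          exact h1 fun w hw => by rw [h w u (hmem u v w hw)]; exact h3 w hw
        · rintro ⟨w, hw, h0⟩
          exact h2 ⟨w, hw, by rw [h w u (hmem u v w hw)]; exact h0⟩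
  have hmono : ∀ t u v, G.Adj u v → μ t u v ≠ 2 → μ (t + 1) u v = μ t u v := by
    intro t
    induction t with
    | zero => intro u v huv h; exact absurd (hinit u v huv) h
    | succ t ih =>
      intro u v huv h
      by_cases h1 : ∀ w ∈ (G.neighborFinset u).erase v, μ t w u = 1
      · rw [hLrule t u v huv h1, hLrule (t + 1) u v huv]
        intro w hw
        rw [ih w u (hmem u v w hw) (by rw [h1 w hw]; decide)]; exact h1 w hw
      · by_cases h2 : ∃ w ∈ (G.neighborFinset u).erase v, μ t w u = 0
        · rw [hMrule t u v huv h2, hMrule (t + 1) u v huv]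
          obtain ⟨w, hw, h0⟩ := h2
          exact ⟨w, hw, by rw [ih w u (hmem u v w hw) (by rw [h0]; decide)]; exact h0⟩
        · exact absurd (hUrule t u v huv h1 h2) h
  have key : ∃ T ≤ 2 * G.edgeFinset.card, ∀ u v : V, G.Adj u v → μ (T + 1) u v = μ T u v := by
    by_contra! hcon
    have hcount : ∀ T ≤ 2 * G.edgeFinset.card + 1,
        T ≤ (Finset.univ.filter fun d : G.Dart => μ T d.fst d.snd ≠ 2).card := by
      intro T
      induction T with
      | zero => intro _; exact Nat.zero_le _
      | succ T ih =>
        intro hT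
        refine Nat.succ_le_of_lt (lt_of_le_of_lt (ih (by omega)) (Finset.card_lt_card ?_))
        rw [Finset.ssubset_iff_of_subset]
        · obtain ⟨u, v, huv, hne⟩ := hcon T (by omega)
          have h2 : μ T u v = 2 := by
            by_contra h; exact hne (hmono T u v huv h)
          refine ⟨⟨(u, v), huv⟩, ?_, ?_⟩
          · simpa [h2] using hne
          · simp [h2]
        · intro d hd
          simp only [Finset.mem_filter, Finset.mem_univ, true_and] at hd ⊢
          rw [hmono T _ _ d.adj hd]; exact hd
    have h1 := hcount _ le_rfl
    have h2 := Finset.card_le_univ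
      (Finset.univ.filter fun d : G.Dart => μ (2 * G.edgeFinset.card + 1) d.fst d.snd ≠ 2)
    rw [G.dart_card_eq_twice_card_edges] at h2
    omega
  obtain ⟨T, hT, hs⟩ := key
  refine ⟨T, hT, ?_, hs⟩
  intro t ht
  induction t, ht using Nat.le_induction with
  | base => intro u v _; rfl
  | succ t _ ih =>
    intro u v huv
    rw [hdet t T ih u v huv, hs u v huv]
end
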